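/- arXiv:1907.06032 — 5 statements merged into one kernel-verified Lean document; each statement's English description precedes it below -/
import Mathlib

section
/- Every finite family of nonzero vectors in ℝ^m admits a minimal subspace segmentation; that is, for every finite family X = (x_j)_{j∈J} of nonzero vectors in ℝ^m there exists a partition {J_0, J_1, …, J_K} of J (with K ≥ 0 and the piece J_0 possibly absent) that is a minimal subspace segmentation of X. -/
open Submodule Module Finset

noncomputable section

variable {m : ℕ} {ι : Type*}

/-- The subspace spanned by the subfamily of `x` indexed by `S`. -/
def spanOf (x : ι → EuclideanSpace ℝ (Fin m)) (S : Finset ι) :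
    Submodule ℝ (EuclideanSpace ℝ (Fin m)) :=
  Submodule.span ℝ (x '' (S : Set ι))

/-- The rank `r(X_S)` of the subfamily of `x` indexed by `S`. -/
def rOf (x : ι → EuclideanSpace ℝ (Fin m)) (S : Finset ι) : ℕ :=
  Module.finrank ℝ (spanOf x S)

/-- `X_S` is nondegenerate: every subfamily `X_T`, `T ⊆ S`, has rank `min |T| r(X_S)`. -/
def Nondeg (x : ι → EuclideanSpace ℝ (Fin m)) (S : Finset ι) : Prop :=
  ∀ T ⊆ S, rOf x T = min T.card (rOf x S)

/-- `span(X_S)` is a minimal sample subspace: `n(X_S) > r(X_S)` and `X_S` is nondegenerate. -/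
def IsMinimalSeg (x : ι → EuclideanSpace ℝ (Fin m)) (S : Finset ι) : Prop :=
  rOf x S < S.card ∧ Nondeg x S

/-- `span(X_S)` is pure: the subfamily `X_S` is linearly independent. -/
def IsPureSeg (x : ι → EuclideanSpace ℝ (Fin m)) (S : Finset ι) : Prop :=
  LinearIndependent ℝ (fun i : {a // a ∈ S} => x i.1)

/-- A minimal subspace segmentation (MSS) `{J_0, J_1, …, J_K}` of the index set
(the pure piece `J_0` may be absent, i.e. empty). -/
structure IsMSS (x : ι → EuclideanSpace ℝ (Fin m)) (K : ℕ) (J0 : Finset ι)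
    (P : Fin K → Finset ι) : Prop where
  cover : ∀ i : ι, i ∈ J0 ∨ ∃ k, i ∈ P k
  disj0 : ∀ k, Disjoint J0 (P k)
  disj : ∀ k ℓ, k ≠ ℓ → Disjoint (P k) (P ℓ)
  pure0 : IsPureSeg x J0
  minimal : ∀ k, IsMinimalSeg x (P k)
  distinct : ∀ k ℓ, k ≠ ℓ → spanOf x (P k) ≠ spanOf x (P ℓ)
  distinct0 : J0.Nonempty → ∀ k, spanOf x J0 ≠ spanOf x (P k)
  sep0 : ∀ j ∈ J0, ∀ k, x j ∉ spanOf x (P k)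

theorem mem_spanOf (x : ι → EuclideanSpace ℝ (Fin m)) {S : Finset ι} {i : ι} (hi : i ∈ S) :
    x i ∈ spanOf x S :=
  Submodule.subset_span ⟨i, hi, rfl⟩

theorem spanOf_mono (x : ι → EuclideanSpace ℝ (Fin m)) {S T : Finset ι} (h : S ⊆ T) :
    spanOf x S ≤ spanOf x T :=
  Submodule.span_mono (Set.image_mono (Finset.coe_subset.mpr h))

theorem rOf_mono (x : ι → EuclideanSpace ℝ (Fin m)) {S T : Finset ι} (h : S ⊆ T) :
    rOf x S ≤ rOf x T :=
  Submodule.finrank_mono (spanOf_mono x h)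

theorem rOf_le_card (x : ι → EuclideanSpace ℝ (Fin m)) (S : Finset ι) :
    rOf x S ≤ S.card := by
  classical
  rw [rOf, spanOf, ← Finset.coe_image]
  exact (finrank_span_finset_le_card _).trans Finset.card_image_le

theorem isPureSeg_of_card_le (x : ι → EuclideanSpace ℝ (Fin m)) {S : Finset ι}
    (h : S.card ≤ rOf x S) : IsPureSeg x S := by
  rw [IsPureSeg, linearIndependent_iff_card_le_finrank_span, Fintype.card_coe]
  have hr : Set.range (fun i : {a // a ∈ S} => x i.1) = x '' (S : Set ι) := by
    ext v
    simp
  rwa [Set.finrank, hr]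

/-- A family with a linearly dependent subfamily `X_A` has a minimal sample subspace whose
piece consists of all the vectors of `X_A` that lie in it. -/
theorem exists_isMinimalSeg_of_rOf_lt_card (x : ι → EuclideanSpace ℝ (Fin m)) {A : Finset ι}
    (hA : rOf x A < A.card) :
    ∃ B ⊆ A, IsMinimalSeg x B ∧ ∀ i ∈ A, x i ∈ spanOf x B → i ∈ B := by
  classical
  obtain ⟨S, hS, hmin⟩ := Finset.exists_min_image
    (A.powerset.filter fun S => rOf x S < S.card) Finset.card ⟨A, by simpa using hA⟩
  simp only [Finset.mem_filter, Finset.mem_powerset] at hS hmin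
  obtain ⟨hSA, hSlt⟩ := hS
  have rank_small : ∀ T ⊆ A, T.card < S.card → rOf x T = T.card := fun T hT hc =>
    (rOf_le_card x T).antisymm (not_lt.mp fun h => absurd (hmin T ⟨hT, h⟩) (by omega))
  have hrS : rOf x S + 1 = S.card := by
    obtain ⟨a, ha⟩ : S.Nonempty := Finset.card_pos.mp (by omega)
    have hc := Finset.card_erase_add_one ha
    have h1 := rank_small (S.erase a) ((Finset.erase_subset _ _).trans hSA) (by omega)
    have h2 := rOf_mono x (Finset.erase_subset a S)
    omega
  let B := A.filter fun i => x i ∈ spanOf x S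
  have hBA : B ⊆ A := Finset.filter_subset _ _
  have hSB : S ⊆ B := fun i hi => Finset.mem_filter.mpr ⟨hSA hi, mem_spanOf x hi⟩
  have hspan : spanOf x B = spanOf x S := by
    refine le_antisymm (Submodule.span_le.mpr ?_) (spanOf_mono x hSB)
    rintro _ ⟨i, hi, rfl⟩
    exact (Finset.mem_filter.mp hi).2
  have hrB : rOf x B = rOf x S := by rw [rOf, hspan, rOf]
  refine ⟨B, hBA, ⟨?_, fun T hT => ?_⟩, fun i hi hxi =>
    Finset.mem_filter.mpr ⟨hi, hspan ▸ hxi⟩⟩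
  · have := Finset.card_le_card hSB
    omega
  · rcases lt_or_ge T.card S.card with hc | hc
    · rw [rank_small T (hT.trans hBA) hc]
      omega
    · obtain ⟨T', hT', hc'⟩ := Finset.exists_subset_card_eq (show rOf x S ≤ T.card by omega)
      have h1 := rank_small T' ((hT'.trans hT).trans hBA) (by omega)
      have h2 := rOf_mono x hT'
      have h3 := rOf_mono x hT
      omega

theorem exists_segmentation_of_finset (x : ι → EuclideanSpace ℝ (Fin m)) (A : Finset ι) :
    ∃ (K : ℕ) (J0 : Finset ι) (P : Fin K → Finset ι),
      J0 ⊆ A ∧ (∀ k, P k ⊆ A) ∧ (∀ i ∈ A, i ∈ J0 ∨ ∃ k, i ∈ P k) ∧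
      (∀ k, Disjoint J0 (P k)) ∧ (∀ k ℓ, k ≠ ℓ → Disjoint (P k) (P ℓ)) ∧
      IsPureSeg x J0 ∧ (∀ k, IsMinimalSeg x (P k)) ∧
      (∀ k ℓ, k ≠ ℓ → spanOf x (P k) ≠ spanOf x (P ℓ)) ∧
      ∀ j ∈ J0, ∀ k, x j ∉ spanOf x (P k) := by
  classical
  induction A using Finset.strongInduction with
  | H A ih =>
  rcases le_or_gt A.card (rOf x A) with hA | hA
  · exact ⟨0, A, Fin.elim0, subset_rfl, fun k => k.elim0, fun i hi => Or.inl hi,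
      fun k => k.elim0, fun k => k.elim0, isPureSeg_of_card_le x hA, fun k => k.elim0,
      fun k => k.elim0, fun _ _ k => k.elim0⟩
  obtain ⟨B, hBA, hB, hmax⟩ := exists_isMinimalSeg_of_rOf_lt_card x hA
  have hBne : B.Nonempty := Finset.card_pos.mp (Nat.zero_lt_of_lt hB.1)
  obtain ⟨K, J0, P, hJ, hP, hcov, hd0, hd, hpure, hminl, hdist, hsep⟩ :=
    ih (A \ B) (Finset.sdiff_ssubset hBA hBne)
  have not_mem : ∀ i ∈ A \ B, x i ∉ spanOf x B := fun i hi h =>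
    (Finset.mem_sdiff.mp hi).2 (hmax i (Finset.mem_sdiff.mp hi).1 h)
  have disjB : ∀ {T : Finset ι}, T ⊆ A \ B → Disjoint T B := fun hT =>
    Finset.disjoint_of_subset_left hT Finset.sdiff_disjoint
  have spanB : ∀ k, spanOf x (P k) ≠ spanOf x B := fun k h => by
    obtain ⟨i, hi⟩ : (P k).Nonempty := Finset.card_pos.mp (Nat.zero_lt_of_lt (hminl k).1)
    exact not_mem i (hP k hi) (h ▸ mem_spanOf x hi)
  refine ⟨K + 1, J0, Fin.cons B P, hJ.trans Finset.sdiff_subset, ?_, ?_, ?_, ?_, hpure,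
    ?_, ?_, ?_⟩
  · exact Fin.cases hBA fun k => (hP k).trans Finset.sdiff_subset
  · intro i hi
    by_cases hiB : i ∈ B
    · exact Or.inr ⟨0, hiB⟩
    · exact (hcov i (Finset.mem_sdiff.mpr ⟨hi, hiB⟩)).imp_right fun ⟨k, hk⟩ => ⟨k.succ, hk⟩
  · exact Fin.cases (disjB hJ) hd0
  · refine Fin.cases (Fin.cases (fun h => absurd rfl h) fun ℓ _ => (disjB (hP ℓ)).symm)
      fun k => Fin.cases (fun _ => disjB (hP k)) fun ℓ h => ?_
    exact hd k ℓ fun e => h (congrArg Fin.succ e)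
  · exact Fin.cases hB hminl
  · refine Fin.cases (Fin.cases (fun h => absurd rfl h) fun ℓ _ => (spanB ℓ).symm)
      fun k => Fin.cases (fun _ => spanB k) fun ℓ h => ?_
    exact hdist k ℓ fun e => h (congrArg Fin.succ e)
  · exact fun j hj => Fin.cases (not_mem j (hJ hj)) (hsep j hj)

/-- Every finite family of nonzero vectors in `ℝ^m` admits a minimal
subspace segmentation. -/
theorem mss_exists [Fintype ι]
    (x : ι → EuclideanSpace ℝ (Fin m)) (hx : ∀ j, x j ≠ 0) :
    ∃ (K : ℕ) (J0 : Finset ι) (P : Fin K → Finset ι), IsMSS x K J0 P := by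
  obtain ⟨K, J0, P, -, -, hcov, hd0, hd, hpure, hminl, hdist, hsep⟩ :=
    exists_segmentation_of_finset x Finset.univ
  exact ⟨K, J0, P, fun i => hcov i (Finset.mem_univ i), hd0, hd, hpure, hminl, hdist,
    fun ⟨j, hj⟩ k h => hsep j hj k (h ▸ mem_spanOf x hj), hsep⟩
end
end

section
/- Let {X_1, …, X_K} be a minimal subspace segmentation of X with no pure segment. If no sample x_j lies in S_k ∩ S_ℓ for any k ≠ ℓ, and n_k > d_k + (K−1)d_0 for all k, then for every J = {J_1, …, J_K} ∈ J(K, d, d_min) and every k ∈ {1, …, K} there exists a piece J_i with |J_{ik}| ≥ d_k (that is, max_i |J_{ik}| ≥ d_k). -/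
open Submodule Module Finset

noncomputable section

variable {m : ℕ} {ι : Type*}

/-- The component of `x i` in the orthogonal complement of `W ⊓ S'` within `W`. -/
def zComp (x : ι → EuclideanSpace ℝ (Fin m))
    (W S' : Submodule ℝ (EuclideanSpace ℝ (Fin m))) (i : ι) :
    EuclideanSpace ℝ (Fin m) :=
  (orthogonalProjection (W ⊓ (W ⊓ S')ᗮ) (x i) : EuclideanSpace ℝ (Fin m))

/-- The segmentation `{X_1, …, X_K}` is intersected nondegenerately: for every `k` and every
subfamily indexed by `S` disjoint from `P k`, the family of components of the vectors of `X_k`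
in the orthogonal complement (within `span(X_k)`) of `span(X_k) ⊓ span(X_S)` is zero or
nondegenerate. -/
def IntNondeg (x : ι → EuclideanSpace ℝ (Fin m)) {K : ℕ}
    (P : Fin K → Finset ι) : Prop :=
  ∀ (k : Fin K) (S : Finset ι), Disjoint S (P k) →
    (∀ i ∈ P k, zComp x (spanOf x (P k)) (spanOf x S) i = 0) ∨
      Nondeg (zComp x (spanOf x (P k)) (spanOf x S)) (P k)

/-- A minimal subspace segmentation of `X` with no pure segment, with index pieces
`P 1, …, P K`. -/
structure IsMSSnp (x : ι → EuclideanSpace ℝ (Fin m)) {K : ℕ}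
    (P : Fin K → Finset ι) : Prop where
  cover : ∀ i : ι, ∃ k, i ∈ P k
  disj : ∀ k ℓ, k ≠ ℓ → Disjoint (P k) (P ℓ)
  minimal : ∀ k, IsMinimalSeg x (P k)
  distinct : ∀ k ℓ, k ≠ ℓ → spanOf x (P k) ≠ spanOf x (P ℓ)

/-- The non-intersection condition for the minimal segments. -/
def NonIntersect (x : ι → EuclideanSpace ℝ (Fin m)) {K : ℕ}
    (P : Fin K → Finset ι) : Prop :=
  ∀ (j : ι) (k ℓ : Fin K), k ≠ ℓ → x j ∉ spanOf x (P k) ⊓ spanOf x (P ℓ)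

/-- The set `𝒥(K, d, dmin)`: partitions of the index set into `K` pieces, each of size
greater than `dmin`, whose segment ranks sum to at most `d`. -/
def InJSet (x : ι → EuclideanSpace ℝ (Fin m)) (K d dmin : ℕ)
    (Q : Fin K → Finset ι) : Prop :=
  (∀ i : ι, ∃ k, i ∈ Q k) ∧ (∀ k ℓ, k ≠ ℓ → Disjoint (Q k) (Q ℓ)) ∧
    (∀ k, dmin < (Q k).card) ∧ (∑ k, rOf x (Q k)) ≤ d

/-- If each `S k` meets the sum of the others in dimension at most `c`, then subspaces `U k ≤ S k`
lose at most `c` dimensions per summand after the first when they are added up. -/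
theorem sum_finrank_add_le_finrank_biSup {F V κ : Type*} [DivisionRing F] [AddCommGroup V]
    [Module F V] [FiniteDimensional F V] (S U : κ → Submodule F V) (c : ℕ)
    (hU : ∀ k, U k ≤ S k)
    (hc : ∀ k, finrank F ↥(S k ⊓ ⨆ (j) (_ : j ≠ k), S j) ≤ c)
    {T : Finset κ} (hT : T.Nonempty) :
    ∑ k ∈ T, finrank F (U k) + c ≤ finrank F ↥(⨆ k ∈ T, U k) + ∑ _k ∈ T, c := by
  induction hT using Finset.Nonempty.cons_induction with
  | singleton a =>
    have hsup : ⨆ k ∈ ({a} : Finset κ), U k = U a := by simp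
    rw [hsup, Finset.sum_singleton, Finset.sum_singleton]
  | cons a s ha hs ih =>
    have hsup : ⨆ k ∈ Finset.cons a s ha, U k = U a ⊔ ⨆ k ∈ s, U k := by
      simp [iSup_or, iSup_sup_eq]
    have hle : U a ⊓ (⨆ k ∈ s, U k) ≤ S a ⊓ ⨆ (j) (_ : j ≠ a), S j := by
      refine inf_le_inf (hU a) (iSup₂_le fun k hk => (hU k).trans ?_)
      exact le_iSup₂_of_le k (fun h => ha (h ▸ hk)) le_rfl
    have hinf := (Submodule.finrank_mono hle).trans (hc a)
    have hdim := Submodule.finrank_sup_add_finrank_inf_eq (U a) (⨆ k ∈ s, U k)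
    rw [hsup, Finset.sum_cons, Finset.sum_cons]
    omega

/-- The pieces of a partition cut any finset into parts whose sizes add up to its size. -/
theorem sum_card_inter_eq_card {κ α : Type*} [Fintype κ] [DecidableEq α] (Q : κ → Finset α)
    (hcover : ∀ i, ∃ k, i ∈ Q k) (hdisj : ∀ k l, k ≠ l → Disjoint (Q k) (Q l))
    (S : Finset α) : ∑ i, (Q i ∩ S).card = S.card := by
  rw [← Finset.card_biUnion fun i _ j _ hij =>
    (hdisj i j hij).mono Finset.inter_subset_left Finset.inter_subset_left]
  congr 1
  ext a
  obtain ⟨k, hk⟩ := hcover a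
  simp only [Finset.mem_biUnion, Finset.mem_univ, true_and, Finset.mem_inter]
  exact ⟨fun ⟨_, h⟩ => h.2, fun h => ⟨k, hk, h⟩⟩

/-- If no sample lies in `S_k ∩ S_ℓ` for `k ≠ ℓ` and
`n_k > d_k + (K−1)·d_0` for all `k`, then every minimal segment is dominated by some piece of
any partition in `𝒥(K, d, dmin)`: `max_i |J_{ik}| ≥ d_k`. -/
theorem dominating_piece_exists [Fintype ι] [DecidableEq ι]
    (x : ι → EuclideanSpace ℝ (Fin m)) {K : ℕ} (P : Fin K → Finset ι)
    (hmss : IsMSSnp x P)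
    (d dmin d0 : ℕ)
    (hd : d = ∑ k, rOf x (P k))
    (hdmin : IsLeast (Set.range fun k => rOf x (P k)) dmin)
    (hd0 : IsGreatest (Set.range fun k =>
      Module.finrank ℝ ↥(spanOf x (P k) ⊓ ⨆ (j) (_ : j ≠ k), spanOf x (P j))) d0)
    (hni : NonIntersect x P)
    (hn : ∀ k, rOf x (P k) + (K - 1) * d0 < (P k).card)
    (Q : Fin K → Finset ι) (hQ : InJSet x K d dmin Q) :
    ∀ k : Fin K, ∃ i : Fin K, rOf x (P k) ≤ (Q i ∩ P k).card := by
  classical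
  by_contra! hcon
  obtain ⟨k₀, hk₀⟩ := hcon
  obtain ⟨hcover, hdisj, -, hrank⟩ := hQ
  have hchoice : ∀ k, ∃ i : Fin K, (∀ i', (Q i' ∩ P k).card < rOf x (P k)) ∨
      rOf x (P k) ≤ (Q i ∩ P k).card := by
    intro k
    by_cases h : ∀ i', (Q i' ∩ P k).card < rOf x (P k)
    · exact ⟨k₀, Or.inl h⟩
    · push Not at h
      exact h.imp fun i hi => Or.inr hi
  choose f hf using hchoice
  let T : Fin K → Finset (Fin K) := fun i =>
    Finset.univ.filter fun k => (∀ i', (Q i' ∩ P k).card < rOf x (P k)) ∨ f k = i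
  have hTmem : ∀ i k, k ∈ T i ↔ (∀ i', (Q i' ∩ P k).card < rOf x (P k)) ∨ f k = i := by
    simp [T]
  have hr : ∀ i k, rOf x (Q i ∩ P k) = min (Q i ∩ P k).card (rOf x (P k)) := fun i k =>
    (hmss.minimal k).2 _ Finset.inter_subset_right
  have hpiece : ∀ i, ∑ k ∈ T i, rOf x (Q i ∩ P k) + d0 ≤ rOf x (Q i) + ∑ _k ∈ T i, d0 := by
    intro i
    refine (sum_finrank_add_le_finrank_biSup (fun k => spanOf x (P k))
      (fun k => spanOf x (Q i ∩ P k)) d0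
      (fun k => spanOf_mono x Finset.inter_subset_right) (fun k => hd0.2 ⟨k, rfl⟩)
      ⟨k₀, (hTmem i k₀).2 (Or.inl hk₀)⟩).trans ?_
    gcongr
    exact Submodule.finrank_mono
      (iSup₂_le fun k _ => spanOf_mono x Finset.inter_subset_left)
  have hundom : ∀ k, (∀ i', (Q i' ∩ P k).card < rOf x (P k)) →
      rOf x (P k) + ∑ i, (if k ∈ T i then d0 else 0) <
        ∑ i, (if k ∈ T i then rOf x (Q i ∩ P k) else 0) + d0 := by
    intro k hk
    have hmem : ∀ i, k ∈ T i := fun i => (hTmem i k).2 (Or.inl hk)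
    have hsum : ∑ i, rOf x (Q i ∩ P k) = (P k).card := by
      rw [← sum_card_inter_eq_card Q hcover hdisj (P k)]
      exact Finset.sum_congr rfl fun i _ => (hr i k).trans (min_eq_left (hk i).le)
    have hK : (K - 1) * d0 + d0 = K * d0 := by
      rw [← Nat.succ_mul, Nat.succ_eq_add_one, Nat.sub_add_cancel k.pos]
    have := hn k
    simp only [hmem, if_true, hsum, Finset.sum_const, Finset.card_univ, Fintype.card_fin,
      smul_eq_mul]
    omega
  have hsegment : ∀ k, rOf x (P k) + ∑ i, (if k ∈ T i then d0 else 0) ≤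
      ∑ i, (if k ∈ T i then rOf x (Q i ∩ P k) else 0) + d0 := by
    intro k
    by_cases hk : ∀ i', (Q i' ∩ P k).card < rOf x (P k)
    · exact (hundom k hk).le
    · have hmem : ∀ i, k ∈ T i ↔ f k = i := fun i => by rw [hTmem, or_iff_right hk]
      simp only [hmem, Finset.sum_ite_eq, Finset.mem_univ, if_true]
      rw [hr, min_eq_right ((hf k).resolve_left hk)]
  have hlt := Finset.sum_lt_sum (fun k _ => hsegment k)
    ⟨k₀, Finset.mem_univ _, hundom k₀ hk₀⟩
  have hle := Finset.sum_le_sum fun i (_ : i ∈ Finset.univ) => hpiece i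
  have hswap : ∀ g : Fin K → Fin K → ℕ,
      ∑ k, ∑ i, (if k ∈ T i then g i k else 0) = ∑ i, ∑ k ∈ T i, g i k := by
    intro g
    rw [Finset.sum_comm]
    simp
  rw [Finset.sum_add_distrib, Finset.sum_add_distrib, hswap fun _ _ => d0,
    hswap fun i k => rOf x (Q i ∩ P k), ← hd] at hlt
  rw [Finset.sum_add_distrib, Finset.sum_add_distrib] at hle
  omega
end
end

section
/- Let X ∈ ℝ^{m×n} with rank r, let V ∈ ℝ^{n×r} be a matrix whose columns form an orthonormal basis of the row space of X (the column space of Xᵀ), and let V_⊥ ∈ ℝ^{n×(n−r)} be such that [V, V_⊥] is orthogonal. Then: (i) a matrix C ∈ ℝ^{n×n} satisfies X = XC if and only if C = VVᵀ + V_⊥H for some H ∈ ℝ^{(n−r)×n}; (ii) every such C satisfies rank(C) ≥ rank(X); (iii) if in addition C is symmetric, then C = VVᵀ + V_⊥SV_⊥ᵀ for some symmetric S ∈ ℝ^{(n−r)×(n−r)}; (iv) if X ≠ 0, X = XC, and trace(C) = 0, then rank(C) ≥ rank(X) + 1. -/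
open Matrix

noncomputable section

/-- If the column space of `M` is contained in that of `N`, then `M` factors through `N`. -/
theorem Matrix.exists_eq_mul_of_range_mulVecLin_le {R l m n : Type*} [CommSemiring R] [Fintype m]
    [Fintype n] [DecidableEq m] {M : Matrix l m R} {N : Matrix l n R}
    (h : LinearMap.range M.mulVecLin ≤ LinearMap.range N.mulVecLin) :
    ∃ A : Matrix n m R, M = N * A := by
  have key : ∀ j, ∃ a : n → R, N *ᵥ a = M.col j := fun j => by
    have hj : M.col j ∈ LinearMap.range M.mulVecLin := ⟨Pi.single j 1, by simp⟩
    simpa using h hj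
  choose a ha using key
  refine ⟨(Matrix.of a)ᵀ, ?_⟩
  ext i j
  exact (congrFun (ha j) i).symm

/-- If `X * C = X` and `C` has rank at most that of `X`, then `X` and `C` have the same
row space. -/
theorem Matrix.range_transpose_mulVecLin_eq_of_mul_eq_self {K m n : Type*} [Field K] [Fintype m]
    [Fintype n] {X : Matrix m n K} {C : Matrix n n K} (hC : X * C = X)
    (hrank : C.rank ≤ X.rank) :
    LinearMap.range Xᵀ.mulVecLin = LinearMap.range Cᵀ.mulVecLin := by
  apply Submodule.eq_of_le_of_finrank_le
  · conv_lhs => rw [← hC, Matrix.transpose_mul, Matrix.mulVecLin_mul]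
    exact LinearMap.range_comp_le_range _ _
  · change Cᵀ.rank ≤ Xᵀ.rank
    rwa [Matrix.rank_transpose, Matrix.rank_transpose]

/-- closed form of the representation matrices of `X`.
`V` has orthonormal columns spanning the row space of `X` (the column space of `Xᵀ`), and
`[V, V⊥]` is an orthogonal matrix. -/
theorem representation_matrix_closed_form {m n : ℕ} (X : Matrix (Fin m) (Fin n) ℝ)
    (V : Matrix (Fin n) (Fin X.rank) ℝ) (Vp : Matrix (Fin n) (Fin (n - X.rank)) ℝ)
    (hV : Vᵀ * V = 1)
    (hVspan : LinearMap.range V.mulVecLin = LinearMap.range Xᵀ.mulVecLin)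
    (hVp : Vpᵀ * Vp = 1) (hVVp : Vᵀ * Vp = 0)
    (hcomplete : V * Vᵀ + Vp * Vpᵀ = 1) :
    (∀ C : Matrix (Fin n) (Fin n) ℝ,
        X * C = X ↔ ∃ H : Matrix (Fin (n - X.rank)) (Fin n) ℝ, C = V * Vᵀ + Vp * H) ∧
    (∀ C : Matrix (Fin n) (Fin n) ℝ, X * C = X → X.rank ≤ C.rank) ∧
    (∀ C : Matrix (Fin n) (Fin n) ℝ, X * C = X → C.IsSymm →
        ∃ S : Matrix (Fin (n - X.rank)) (Fin (n - X.rank)) ℝ,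
          S.IsSymm ∧ C = V * Vᵀ + Vp * S * Vpᵀ) ∧
    (∀ C : Matrix (Fin n) (Fin n) ℝ, X ≠ 0 → X * C = X → C.trace = 0 →
        X.rank + 1 ≤ C.rank) := by
  obtain ⟨A, hA⟩ := Matrix.exists_eq_mul_of_range_mulVecLin_le hVspan.le
  obtain ⟨B, hB⟩ := Matrix.exists_eq_mul_of_range_mulVecLin_le hVspan.ge
  have hVt : Vᵀ = Aᵀ * X := by
    simpa using congrArg Matrix.transpose hA
  have hX : X = Bᵀ * Vᵀ := by
    simpa using congrArg Matrix.transpose hB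
  have hVC : ∀ C : Matrix (Fin n) (Fin n) ℝ, X * C = X → Vᵀ * C = Vᵀ := fun C hC => by
    rw [hVt, Matrix.mul_assoc, hC]
  have hsplit : ∀ C : Matrix (Fin n) (Fin n) ℝ, X * C = X →
      C = V * Vᵀ + Vp * (Vpᵀ * C) := fun C hC => by
    calc C = (V * Vᵀ + Vp * Vpᵀ) * C := by rw [hcomplete, Matrix.one_mul]
      _ = V * Vᵀ + Vp * (Vpᵀ * C) := by
        rw [Matrix.add_mul, Matrix.mul_assoc, hVC C hC, Matrix.mul_assoc]
  have hle : ∀ C : Matrix (Fin n) (Fin n) ℝ, X * C = X → X.rank ≤ C.rank := fun C hC => by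
    conv_lhs => rw [← hC]
    exact Matrix.rank_mul_le_right X C
  refine ⟨fun C => ⟨fun hC => ⟨Vpᵀ * C, hsplit C hC⟩, ?_⟩, hle, ?_, ?_⟩
  · rintro ⟨H, rfl⟩
    have hXV : X * (V * Vᵀ) = X := by
      calc X * (V * Vᵀ) = Bᵀ * Vᵀ * (V * Vᵀ) := congrArg (· * (V * Vᵀ)) hX
        _ = Bᵀ * (Vᵀ * V) * Vᵀ := by simp only [Matrix.mul_assoc]
        _ = X := by rw [hV, Matrix.mul_one, ← hX]
    have hXVp : X * (Vp * H) = 0 := by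
      calc X * (Vp * H) = Bᵀ * Vᵀ * (Vp * H) := congrArg (· * (Vp * H)) hX
        _ = Bᵀ * (Vᵀ * Vp) * H := by simp only [Matrix.mul_assoc]
        _ = 0 := by rw [hVVp, Matrix.mul_zero, Matrix.zero_mul]
    rw [Matrix.mul_add, hXV, hXVp, add_zero]
  · intro C hC hsymm
    refine ⟨Vpᵀ * C * Vp, ?_, ?_⟩
    · simp [Matrix.IsSymm, Matrix.transpose_mul, hsymm.eq, Matrix.mul_assoc]
    · have hCV : C * V = V := by
        simpa [Matrix.transpose_mul, hsymm.eq] using congrArg Matrix.transpose (hVC C hC)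
      have hCVp : C * Vp = Vp * (Vpᵀ * C * Vp) := by
        conv_lhs => rw [hsplit C hC]
        rw [Matrix.add_mul, Matrix.mul_assoc V, hVVp, Matrix.mul_zero, zero_add, Matrix.mul_assoc]
      calc C = C * (V * Vᵀ + Vp * Vpᵀ) := by rw [hcomplete, Matrix.mul_one]
        _ = C * V * Vᵀ + C * Vp * Vpᵀ := by
          rw [Matrix.mul_add, Matrix.mul_assoc, Matrix.mul_assoc]
        _ = V * Vᵀ + Vp * (Vpᵀ * C * Vp) * Vpᵀ := by rw [hCV, hCVp]
  · intro C hX0 hC htr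
    by_contra! hlt
    have hrange := Matrix.range_transpose_mulVecLin_eq_of_mul_eq_self hC (Nat.lt_succ_iff.mp hlt)
    obtain ⟨E, hE⟩ := Matrix.exists_eq_mul_of_range_mulVecLin_le (hVspan.trans hrange).ge
    have hCE : C = Eᵀ * Vᵀ := by
      simpa using congrArg Matrix.transpose hE
    have hone : Vᵀ * Eᵀ = 1 := by
      calc Vᵀ * Eᵀ = Vᵀ * Eᵀ * (Vᵀ * V) := by rw [hV, Matrix.mul_one]
        _ = Vᵀ * (Eᵀ * Vᵀ) * V := by simp only [Matrix.mul_assoc]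
        _ = 1 := by rw [← hCE, hVC C hC, hV]
    rw [hCE, Matrix.trace_mul_comm, hone, Matrix.trace_one, Fintype.card_fin] at htr
    have hrank : X.rank = 0 := by exact_mod_cast htr
    have : IsEmpty (Fin X.rank) := by rw [hrank]; infer_instance
    exact hX0 (hX.trans (by ext; simp [Matrix.mul_apply]))
end
end

section
/- Let X ∈ ℝ^{m×n}, let {J_1, …, J_L} be a partition of the column index set {1, …, n}, and let P ∈ ℝ^{n×n} be the matrix of the orthogonal projection of ℝⁿ onto the row space of X (equivalently, P = VVᵀ for any matrix V whose columns are an orthonormal basis of the column space of Xᵀ). Then P is block-diagonal with respect to {J_1, …, J_L} if and only if rank(X) = Σ_{ℓ=1}^{L} rank(X_{J_ℓ}), where X_{J_ℓ} denotes the submatrix of X with columns indexed by J_ℓ. -/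
open Matrix

noncomputable section

/-- The rank of the column subfamily of `X` indexed by `S`: the dimension of the span of
the columns `{X(:, j) : j ∈ S}`. -/
def colSpanRank {m n : ℕ} (X : Matrix (Fin m) (Fin n) ℝ) (S : Finset (Fin n)) : ℕ :=
  Module.finrank ℝ (Submodule.span ℝ ((fun j => Xᵀ j) '' (S : Set (Fin n))))

/-- `C` is block-diagonal with respect to the partition `{Q ℓ}` of the column indices:
`C i j = 0` whenever `i` and `j` lie in different pieces. -/
def IsBlockDiag {n L : ℕ} (C : Matrix (Fin n) (Fin n) ℝ) (Q : Fin L → Finset (Fin n)) :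
    Prop :=
  ∀ i j : Fin n, (¬ ∃ ℓ, i ∈ Q ℓ ∧ j ∈ Q ℓ) → C i j = 0

/-- The sum map `Π i, V i → E`, `v ↦ ∑ i, v i`, of a finite family of submodules. -/
def submoduleSum {K E ι : Type*} [Field K] [AddCommGroup E] [Module K E] [Fintype ι]
    (V : ι → Submodule K E) : (Π i, V i) →ₗ[K] E :=
  ∑ i, (V i).subtype ∘ₗ LinearMap.proj i

theorem submoduleSum_apply {K E ι : Type*} [Field K] [AddCommGroup E] [Module K E] [Fintype ι]
    (V : ι → Submodule K E) (v : Π i, V i) : submoduleSum V v = ∑ i, (v i : E) := by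
  simp [submoduleSum]

theorem finrank_range_submoduleSum_eq_sum_iff {K E ι : Type*} [Field K] [AddCommGroup E]
    [Module K E] [FiniteDimensional K E] [Fintype ι] (V : ι → Submodule K E) :
    Module.finrank K (LinearMap.range (submoduleSum V)) = ∑ i, Module.finrank K (V i) ↔
      ∀ v : Π i, V i, ∑ i, (v i : E) = 0 → v = 0 := by
  have h := LinearMap.finrank_range_add_finrank_ker (submoduleSum V)
  rw [Module.finrank_pi_fintype] at h
  rw [← h, eq_comm, Nat.add_eq_left, Submodule.finrank_eq_zero, LinearMap.ker_eq_bot']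
  simp only [submoduleSum_apply]

/-- The diagonal `0`-`1` matrix selecting the coordinates in `S`. -/
def coordProj {n : ℕ} (S : Finset (Fin n)) : Matrix (Fin n) (Fin n) ℝ :=
  diagonal fun j => if j ∈ S then 1 else 0

theorem coordProj_transpose {n : ℕ} (S : Finset (Fin n)) : (coordProj S)ᵀ = coordProj S := by
  simp [coordProj]

theorem coordProj_mul_self {n : ℕ} (S : Finset (Fin n)) :
    coordProj S * coordProj S = coordProj S := by
  simp [coordProj]

theorem coordProj_mul_of_disjoint {n : ℕ} {S T : Finset (Fin n)} (h : Disjoint S T) :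
    coordProj S * coordProj T = 0 := by
  rw [coordProj, coordProj, diagonal_mul_diagonal, diagonal_eq_zero]
  funext j
  by_cases hS : j ∈ S
  · simp [Finset.disjoint_left.mp h hS]
  · simp [hS]

theorem coordProj_mul_mul_apply {n : ℕ} (S T : Finset (Fin n)) (C : Matrix (Fin n) (Fin n) ℝ)
    (i j : Fin n) :
    (coordProj S * C * coordProj T) i j = if i ∈ S ∧ j ∈ T then C i j else 0 := by
  by_cases hS : i ∈ S <;> by_cases hT : j ∈ T <;> simp [coordProj, hS, hT]

theorem sum_coordProj {n L : ℕ} (Q : Fin L → Finset (Fin n))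
    (hcov : ∀ j : Fin n, ∃ ℓ, j ∈ Q ℓ) (hdisj : ∀ k ℓ, k ≠ ℓ → Disjoint (Q k) (Q ℓ)) :
    ∑ ℓ, coordProj (Q ℓ) = 1 := by
  ext i j
  rw [Matrix.sum_apply]
  obtain rfl | hij := eq_or_ne i j
  · obtain ⟨k, hk⟩ := hcov i
    rw [Finset.sum_eq_single k]
    · simp [coordProj, hk]
    · intro l _ hl
      simp [coordProj, Finset.disjoint_left.mp (hdisj k l hl.symm) hk]
    · simp
  · simp [coordProj, hij]

theorem isBlockDiag_iff_coordProj_mul_mul {n L : ℕ} (C : Matrix (Fin n) (Fin n) ℝ)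
    (Q : Fin L → Finset (Fin n))
    (hcov : ∀ j : Fin n, ∃ ℓ, j ∈ Q ℓ) (hdisj : ∀ k ℓ, k ≠ ℓ → Disjoint (Q k) (Q ℓ)) :
    IsBlockDiag C Q ↔ ∀ k ℓ, k ≠ ℓ → coordProj (Q k) * C * coordProj (Q ℓ) = 0 := by
  constructor
  · intro h k l hkl
    ext i j
    rw [coordProj_mul_mul_apply]
    split_ifs with hij
    · refine h i j ?_
      rintro ⟨p, hi, hj⟩
      have hpk : p = k := by
        by_contra hne
        exact Finset.disjoint_left.mp (hdisj p k hne) hi hij.1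
      subst hpk
      exact Finset.disjoint_left.mp (hdisj p l hkl) hj hij.2
    · rfl
  · intro h i j hij
    obtain ⟨k, hk⟩ := hcov i
    obtain ⟨l, hl⟩ := hcov j
    have hkl : k ≠ l := by
      rintro rfl
      exact hij ⟨k, hk, hl⟩
    have := congrFun (congrFun (h k l hkl) i) j
    rwa [coordProj_mul_mul_apply, if_pos ⟨hk, hl⟩] at this

theorem colSpanRank_eq_finrank_range {m n : ℕ} (X : Matrix (Fin m) (Fin n) ℝ)
    (S : Finset (Fin n)) :
    colSpanRank X S = Module.finrank ℝ (LinearMap.range (X * coordProj S).mulVecLin) := by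
  have hcol : ∀ j, (X * coordProj S).col j = if j ∈ S then Xᵀ j else 0 := by
    intro j
    ext i
    by_cases hj : j ∈ S <;> simp [coordProj, hj, Matrix.col]
  rw [colSpanRank, range_mulVecLin]
  refine congrArg (fun W : Submodule ℝ (Fin m → ℝ) => Module.finrank ℝ W) ?_
  apply le_antisymm <;> rw [Submodule.span_le]
  · rintro _ ⟨j, hj, rfl⟩
    refine Submodule.subset_span ⟨j, ?_⟩
    rw [hcol, if_pos (Finset.mem_coe.mp hj)]
  · rintro _ ⟨j, rfl⟩
    rw [hcol]
    split_ifs with hj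
    · exact Submodule.subset_span ⟨j, hj, rfl⟩
    · exact Submodule.zero_mem _

theorem rank_eq_sum_colSpanRank_iff {m n L : ℕ} (X : Matrix (Fin m) (Fin n) ℝ)
    (Q : Fin L → Finset (Fin n))
    (hcov : ∀ j : Fin n, ∃ ℓ, j ∈ Q ℓ) (hdisj : ∀ k ℓ, k ≠ ℓ → Disjoint (Q k) (Q ℓ)) :
    X.rank = ∑ ℓ, colSpanRank X (Q ℓ) ↔
      ∀ w, X *ᵥ w = 0 → ∀ ℓ, (X * coordProj (Q ℓ)) *ᵥ w = 0 := by
  set V : Fin L → Submodule ℝ (Fin m → ℝ) :=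
    fun l => LinearMap.range (X * coordProj (Q l)).mulVecLin
  have hsum : ∀ w, ∑ l, (X * coordProj (Q l)) *ᵥ w = X *ᵥ w := by
    intro w
    rw [← Matrix.sum_mulVec, ← Matrix.mul_sum, sum_coordProj Q hcov hdisj, Matrix.mul_one]
  have hlift : ∀ v : Π l, V l, ∃ w, ∀ l, (X * coordProj (Q l)) *ᵥ w = v l := by
    intro v
    choose u hu using fun l => (v l).2
    refine ⟨∑ k, coordProj (Q k) *ᵥ u k, fun l => ?_⟩
    rw [Matrix.mulVec_sum, Finset.sum_eq_single l, Matrix.mulVec_mulVec, Matrix.mul_assoc,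
      coordProj_mul_self]
    · exact hu l
    · intro k _ hk
      rw [Matrix.mulVec_mulVec, Matrix.mul_assoc, coordProj_mul_of_disjoint (hdisj l k hk.symm)]
      simp
    · simp
  have hrange : LinearMap.range X.mulVecLin = LinearMap.range (submoduleSum V) := by
    ext y
    constructor
    · rintro ⟨w, rfl⟩
      refine ⟨fun l => ⟨(X * coordProj (Q l)) *ᵥ w, w, rfl⟩, ?_⟩
      rw [submoduleSum_apply]
      exact hsum w
    · rintro ⟨v, rfl⟩
      obtain ⟨w, hw⟩ := hlift v
      refine ⟨w, ?_⟩
      rw [submoduleSum_apply, mulVecLin_apply, ← hsum]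
      exact Finset.sum_congr rfl fun l _ => hw l
  rw [Matrix.rank, hrange, Finset.sum_congr rfl fun l _ => colSpanRank_eq_finrank_range X (Q l),
    finrank_range_submoduleSum_eq_sum_iff V]
  constructor
  · intro h w hw l
    have := h (fun l => ⟨(X * coordProj (Q l)) *ᵥ w, w, rfl⟩) ((hsum w).trans hw)
    exact congrArg Subtype.val (congrFun this l)
  · intro h v hv
    obtain ⟨w, hw⟩ := hlift v
    have hXw : X *ᵥ w = 0 := by
      rw [← hsum, ← hv]
      exact Finset.sum_congr rfl fun l _ => hw l
    funext l
    exact Subtype.ext ((hw l).symm.trans (h w hXw l))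

theorem exists_mul_eq_of_range_mulVecLin_le {m n p : ℕ} (A : Matrix (Fin m) (Fin n) ℝ)
    (B : Matrix (Fin m) (Fin p) ℝ)
    (h : LinearMap.range B.mulVecLin ≤ LinearMap.range A.mulVecLin) :
    ∃ Y : Matrix (Fin n) (Fin p) ℝ, A * Y = B := by
  choose y hy using fun j => h ⟨Pi.single j 1, rfl⟩
  refine ⟨(Matrix.of y)ᵀ, ?_⟩
  ext i j
  have := congrFun (hy j) i
  simpa [Matrix.mul_apply, Matrix.mulVec, dotProduct, Pi.single_apply] using this

/-- The orthogonal projection matrix `P` onto the row space of `X` (the LRR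
solution) is block-diagonal with respect to a partition `{J_ℓ}` of the column indices if and
only if `rank X = Σ_ℓ rank X_{J_ℓ}`. -/
theorem lrr_blockDiag_iff {m n L : ℕ} (X : Matrix (Fin m) (Fin n) ℝ)
    (Q : Fin L → Finset (Fin n))
    (hcov : ∀ j : Fin n, ∃ ℓ, j ∈ Q ℓ) (hdisj : ∀ k ℓ, k ≠ ℓ → Disjoint (Q k) (Q ℓ))
    (P : Matrix (Fin n) (Fin n) ℝ)
    (hPsymm : P.IsSymm) (hPidem : P * P = P)
    (hPrange : LinearMap.range P.mulVecLin = LinearMap.range Xᵀ.mulVecLin) :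
    IsBlockDiag P Q ↔ X.rank = ∑ ℓ, colSpanRank X (Q ℓ) := by
  obtain ⟨Y, hY⟩ := exists_mul_eq_of_range_mulVecLin_le Xᵀ P hPrange.le
  obtain ⟨Z, hZ⟩ := exists_mul_eq_of_range_mulVecLin_le P Xᵀ hPrange.ge
  have hPX : P = Yᵀ * X := by
    rw [← hPsymm.eq, ← hY, transpose_mul, transpose_transpose]
  have hXP : X * P = X := by
    have : P * Xᵀ = Xᵀ := by rw [← hZ, ← Matrix.mul_assoc, hPidem]
    simpa [hPsymm.eq] using congrArg transpose this
  rw [isBlockDiag_iff_coordProj_mul_mul P Q hcov hdisj,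
    rank_eq_sum_colSpanRank_iff X Q hcov hdisj]
  have hone := sum_coordProj Q hcov hdisj
  constructor
  · intro h w hw l
    have hleft : P * coordProj (Q l) = coordProj (Q l) * P * coordProj (Q l) := by
      calc P * coordProj (Q l) = (∑ k, coordProj (Q k)) * P * coordProj (Q l) := by
            rw [hone, Matrix.one_mul]
        _ = ∑ k, coordProj (Q k) * P * coordProj (Q l) := by
            rw [Matrix.sum_mul, Matrix.sum_mul]
        _ = _ := Finset.sum_eq_single l (fun k _ hk => h k l hk) (by simp)
    have hcomm : P * coordProj (Q l) = coordProj (Q l) * P := by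
      have := congrArg transpose hleft
      simp only [transpose_mul, hPsymm.eq, coordProj_transpose] at this
      exact hleft.trans ((Matrix.mul_assoc _ _ _).trans this.symm)
    have hPw : P *ᵥ w = 0 := by
      rw [hPX, ← Matrix.mulVec_mulVec, hw, Matrix.mulVec_zero]
    rw [← hXP, Matrix.mul_assoc, hcomm, ← Matrix.mulVec_mulVec, ← Matrix.mulVec_mulVec, hPw,
      Matrix.mulVec_zero, Matrix.mulVec_zero]
  · intro h k l hkl
    have hker : X * coordProj (Q k) * (P * coordProj (Q l)) = 0 := by
      have hX : X * (P * coordProj (Q l) - coordProj (Q l)) = 0 := by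
        rw [Matrix.mul_sub, ← Matrix.mul_assoc, hXP, sub_self]
      have hD : X * coordProj (Q k) * (P * coordProj (Q l) - coordProj (Q l)) = 0 := by
        refine Matrix.ext_of_mulVec_single fun j => ?_
        rw [← Matrix.mulVec_mulVec, Matrix.zero_mulVec]
        refine h _ ?_ k
        rw [Matrix.mulVec_mulVec, hX, Matrix.zero_mulVec]
      rwa [Matrix.mul_sub, Matrix.mul_assoc X _ (coordProj (Q l)),
        coordProj_mul_of_disjoint (hdisj k l hkl), Matrix.mul_zero, sub_zero] at hD
    rw [← Matrix.conjTranspose_mul_self_eq_zero, conjTranspose_eq_transpose_of_trivial]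
    calc (coordProj (Q k) * P * coordProj (Q l))ᵀ * (coordProj (Q k) * P * coordProj (Q l))
        = coordProj (Q l) * P * (coordProj (Q k) * coordProj (Q k)) * P * coordProj (Q l) := by
          simp only [transpose_mul, hPsymm.eq, coordProj_transpose, Matrix.mul_assoc]
      _ = coordProj (Q l) * (Yᵀ * X) * coordProj (Q k) * P * coordProj (Q l) := by
          rw [coordProj_mul_self, ← hPX]
      _ = coordProj (Q l) * Yᵀ * (X * coordProj (Q k) * (P * coordProj (Q l))) := by
          simp only [Matrix.mul_assoc]
      _ = 0 := by rw [hker, Matrix.mul_zero]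
end
end

section
/- Let X ∈ ℝ^{m×n} and let C ∈ ℝ^{n×n} satisfy X = XC and C_{jj} = 0 for all j. Suppose C is block-diagonal with respect to a partition {J_1, …, J_T} of the column indices into T pieces, and that the submatrix X_{J_ℓ} (columns of X indexed by J_ℓ) is nonzero for each ℓ. Then rank(C) ≥ Σ_{ℓ=1}^{T} rank(X_{J_ℓ}) + T. -/
open Matrix

noncomputable section

/-- If `C` fixes the nonzero matrix `X` on the right and is traceless, its rank exceeds that of `X`:
otherwise `C` would be idempotent, so that its trace would be its rank. -/
lemma rank_add_one_le_of_mul_eq_self {m n : Type*} [Fintype m] [Fintype n] [DecidableEq n]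
    {X : Matrix m n ℝ} {C : Matrix n n ℝ} (hrepr : X * C = X) (htr : C.trace = 0)
    (hX : X ≠ 0) : X.rank + 1 ≤ C.rank := by
  by_contra! h
  have hker : LinearMap.ker C.mulVecLin ≤ LinearMap.ker X.mulVecLin := fun v hv => by
    simp only [LinearMap.mem_ker, mulVecLin_apply] at hv ⊢
    rw [← hrepr, ← mulVec_mulVec, hv, mulVec_zero]
  have hCr := C.mulVecLin.finrank_range_add_finrank_ker
  have hXr := X.mulVecLin.finrank_range_add_finrank_ker
  have hC : Module.finrank ℝ (LinearMap.range C.mulVecLin) = C.rank := rfl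
  have hX' : Module.finrank ℝ (LinearMap.range X.mulVecLin) = X.rank := rfl
  have heq := Submodule.eq_of_le_of_finrank_le hker (by omega)
  have hidem : ∀ v, C *ᵥ (C *ᵥ v) = C *ᵥ v := fun v => by
    have hv : C *ᵥ v - v ∈ LinearMap.ker C.mulVecLin := by
      rw [heq]
      simp [mulVec_sub, hrepr]
    rw [LinearMap.mem_ker, mulVecLin_apply, mulVec_sub, sub_eq_zero] at hv
    exact hv
  have hproj : LinearMap.IsProj (LinearMap.range C.mulVecLin) C.mulVecLin := by
    refine ⟨fun v => ⟨v, rfl⟩, ?_⟩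
    rintro _ ⟨v, rfl⟩
    exact hidem v
  have htrace := hproj.trace
  rw [← toLin'_apply', trace_toLin'_eq, htr, toLin'_apply', hC] at htrace
  have hrank : C.rank = 0 := by exact_mod_cast htrace.symm
  have hX0 : LinearMap.range X.mulVecLin = ⊥ := Submodule.finrank_eq_zero.mp (by
    have := Submodule.finrank_mono hker
    omega)
  apply hX
  ext i j
  have hj : X *ᵥ Pi.single j 1 = 0 := by
    simpa using LinearMap.congr_fun (LinearMap.range_eq_bot.mp hX0) (Pi.single j 1)
  simpa using congrFun hj i

/-- The matrix `A` with the columns outside `S` replaced by zero. -/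
def colRestrict {m n : Type*} [DecidableEq n] (A : Matrix m n ℝ) (S : Finset n) :
    Matrix m n ℝ :=
  of fun i j => if j ∈ S then A i j else 0

lemma colSpanRank_le_rank_colRestrict {m n : ℕ} (X : Matrix (Fin m) (Fin n) ℝ)
    (S : Finset (Fin n)) : colSpanRank X S ≤ (colRestrict X S).rank := by
  refine Submodule.finrank_mono (Submodule.span_le.mpr ?_)
  rintro _ ⟨j, hj, rfl⟩
  refine ⟨Pi.single j 1, ?_⟩
  ext i
  simp_all [colRestrict]

lemma IsBlockDiag.colRestrict_apply_eq_zero {n T : ℕ} {C : Matrix (Fin n) (Fin n) ℝ}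
    {Q : Fin T → Finset (Fin n)} (hbd : IsBlockDiag C Q)
    (hdisj : ∀ k ℓ, k ≠ ℓ → Disjoint (Q k) (Q ℓ)) {ℓ : Fin T} {i : Fin n} (hi : i ∉ Q ℓ)
    (j : Fin n) : colRestrict C (Q ℓ) i j = 0 := by
  by_cases hj : j ∈ Q ℓ
  · simp only [colRestrict, of_apply, hj, if_true]
    refine hbd i j ?_
    rintro ⟨k, hik, hjk⟩
    obtain rfl | hne := eq_or_ne k ℓ
    · exact hi hik
    · exact Finset.disjoint_left.mp (hdisj k ℓ hne) hjk hj
  · simp [colRestrict, hj]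

lemma IsBlockDiag.colRestrict_mul_colRestrict {m n T : ℕ} {X : Matrix (Fin m) (Fin n) ℝ}
    {C : Matrix (Fin n) (Fin n) ℝ} {Q : Fin T → Finset (Fin n)} (hbd : IsBlockDiag C Q)
    (hdisj : ∀ k ℓ, k ≠ ℓ → Disjoint (Q k) (Q ℓ)) (ℓ : Fin T) :
    colRestrict X (Q ℓ) * colRestrict C (Q ℓ) = colRestrict (X * C) (Q ℓ) := by
  have hmul : colRestrict X (Q ℓ) * colRestrict C (Q ℓ) = X * colRestrict C (Q ℓ) := by
    ext i j
    rw [mul_apply, mul_apply]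
    refine Finset.sum_congr rfl fun k _ => ?_
    by_cases hk : k ∈ Q ℓ
    · simp [colRestrict, hk]
    · simp [hbd.colRestrict_apply_eq_zero hdisj hk]
  rw [hmul]
  ext i j
  by_cases hj : j ∈ Q ℓ <;> simp [colRestrict, mul_apply, hj]

/-- The column blocks of a block-diagonal matrix have independent ranges. -/
lemma IsBlockDiag.sum_rank_colRestrict_le {n T : ℕ} {C : Matrix (Fin n) (Fin n) ℝ}
    {Q : Fin T → Finset (Fin n)} (hbd : IsBlockDiag C Q)
    (hdisj : ∀ k ℓ, k ≠ ℓ → Disjoint (Q k) (Q ℓ)) :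
    ∑ ℓ, (colRestrict C (Q ℓ)).rank ≤ C.rank := by
  let R : Fin T → Submodule ℝ (Fin n → ℝ) :=
    fun ℓ => LinearMap.range (colRestrict C (Q ℓ)).mulVecLin
  have hle : ∀ ℓ, R ℓ ≤ LinearMap.range C.mulVecLin := by
    rintro ℓ _ ⟨v, rfl⟩
    refine ⟨fun j => if j ∈ Q ℓ then v j else 0, ?_⟩
    ext i
    simp [mulVec, dotProduct, colRestrict]
  have hsupp : ∀ ℓ (v : R ℓ) i, i ∉ Q ℓ → (v : Fin n → ℝ) i = 0 := by
    rintro ℓ ⟨_, v, rfl⟩ i hi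
    simp [mulVec, dotProduct, hbd.colRestrict_apply_eq_zero hdisj hi]
  let f : (∀ ℓ, R ℓ) →ₗ[ℝ] LinearMap.range C.mulVecLin :=
    ∑ ℓ, Submodule.inclusion (hle ℓ) ∘ₗ LinearMap.proj ℓ
  have hf : Function.Injective f := by
    rw [injective_iff_map_eq_zero]
    intro v hv
    ext ℓ i
    by_cases hi : i ∈ Q ℓ
    · have hvi := congrArg (fun w : LinearMap.range C.mulVecLin => (w : Fin n → ℝ) i) hv
      simp only [f, LinearMap.sum_apply, AddSubmonoidClass.coe_finsetSum, Finset.sum_apply,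
        LinearMap.comp_apply, LinearMap.proj_apply, Submodule.coe_inclusion] at hvi
      rw [Finset.sum_eq_single ℓ (fun k _ hk => hsupp k (v k) i
        (Finset.disjoint_right.mp (hdisj k ℓ hk) hi)) (by simp)] at hvi
      simpa using hvi
    · simpa using hsupp ℓ (v ℓ) i hi
  calc ∑ ℓ, (colRestrict C (Q ℓ)).rank = Module.finrank ℝ (∀ ℓ, R ℓ) :=
        (Module.finrank_pi_fintype ℝ).symm
    _ ≤ C.rank := LinearMap.finrank_le_finrank_of_injective hf

/-- rank bound for SSC-type solutions. If `X = XC`, `C` has zero diagonal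
and is block-diagonal with respect to a partition into `T` pieces with each column block of
`X` nonzero, then `rank C ≥ Σ_ℓ rank X_{J_ℓ} + T`. -/
theorem ssc_rank_bound {m n T : ℕ} (X : Matrix (Fin m) (Fin n) ℝ)
    (C : Matrix (Fin n) (Fin n) ℝ)
    (hrepr : X * C = X) (hdiag : ∀ j, C j j = 0)
    (Q : Fin T → Finset (Fin n))
    (hcov : ∀ j : Fin n, ∃ ℓ, j ∈ Q ℓ) (hdisj : ∀ k ℓ, k ≠ ℓ → Disjoint (Q k) (Q ℓ))
    (hbd : IsBlockDiag C Q)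
    (hnz : ∀ ℓ, ∃ j ∈ Q ℓ, Xᵀ j ≠ 0) :
    (∑ ℓ, colSpanRank X (Q ℓ)) + T ≤ C.rank := by
  calc (∑ ℓ, colSpanRank X (Q ℓ)) + T = ∑ ℓ, (colSpanRank X (Q ℓ) + 1) := by
        simp [Finset.sum_add_distrib]
    _ ≤ ∑ ℓ, (colRestrict C (Q ℓ)).rank := Finset.sum_le_sum fun ℓ _ => ?_
    _ ≤ C.rank := hbd.sum_rank_colRestrict_le hdisj
  refine (Nat.add_le_add_right (colSpanRank_le_rank_colRestrict X (Q ℓ)) 1).trans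
    (rank_add_one_le_of_mul_eq_self ?_ ?_ ?_)
  · rw [hbd.colRestrict_mul_colRestrict hdisj, hrepr]
  · simp [trace, colRestrict, hdiag]
  · obtain ⟨j, hj, hne⟩ := hnz ℓ
    refine fun h => hne (funext fun i => ?_)
    simpa [colRestrict, hj] using congrFun (congrFun h i) j
end
end
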